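/- arXiv:2504.21057 — 5 statements merged into one kernel-verified Lean document; each statement's English description precedes it below -/
import Mathlib

section
/- Let f : S → ℂ satisfy the integral Kannappan multiplicative equation ∫_S f(xσ(y)t) dμ(t) = f(x) f(y) for all x, y ∈ S. Then ∫_S f(t) dμ(t) ≠ 0 if and only if f ≠ 0. -/
/-- Integral of `h` against a finitely supported complex measure `μ` on `S`:
`∫_S h(t) dμ(t) = Σ_t μ(t) h(t)`. -/
noncomputable def mint {S : Type*} (μ : S →₀ ℂ) (h : S → ℂ) : ℂ :=
  μ.sum fun t c => c * h t

theorem mint_const_mul {S : Type*} (μ : S →₀ ℂ) (a : ℂ) (h : S → ℂ) :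
    mint μ (fun t => a * h t) = a * mint μ h := by
  simp only [mint, Finsupp.sum, Finset.mul_sum]
  exact Finset.sum_congr rfl fun t _ => by ring

/-- A nonzero solution of the integral Kannappan equation is of the form `(∫_S g dμ) • g`. -/
theorem exists_eq_mint_mul {S : Type*} [Semigroup S] (σ : S → S)
    (hσmul : ∀ x y : S, σ (x * y) = σ x * σ y) (hσinv : ∀ x : S, σ (σ x) = x)
    (μ : S →₀ ℂ) (f : S → ℂ)
    (hf : ∀ x y : S, mint μ (fun t => f (x * σ y * t)) = f x * f y)
    {a : S} (ha : f a ≠ 0) :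
    ∃ g : S → ℂ, ∀ y, f y = mint μ g * g y := by
  obtain ⟨g, hg⟩ : ∃ g : S → ℂ, ∀ x z, f (x * z) = f x * g z := by
    refine ⟨fun z => f (σ z * a) / f a, fun x z => ?_⟩
    have h₁ := hf (x * z) a
    have h₂ := hf x (σ z * a)
    rw [hσmul, hσinv, ← mul_assoc, h₁] at h₂
    field_simp
    exact h₂
  have hfσ : ∀ y, f y = mint μ g * g (σ y) := by
    intro y
    have h := hf a y
    simp only [hg, mint_const_mul] at h
    apply mul_left_cancel₀ ha
    rw [← h]
    ring
  have hgσ : ∀ z, g (σ z) = g z := by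
    intro z
    have h₂ := hg a z
    have hmul : ∀ u v, g (u * v) = g u * g v := by
      intro u v
      apply mul_left_cancel₀ ha
      rw [← hg, ← mul_assoc, hg, hg, mul_assoc]
    apply mul_left_cancel₀ ha
    rw [← h₂, hfσ (a * z), hσmul, hmul, hfσ a, mul_assoc]
  exact ⟨g, fun y => by rw [← hgσ y]; exact hfσ y⟩

theorem stmt_0 {S : Type*} [Semigroup S] (σ : S → S)
    (hσmul : ∀ x y : S, σ (x * y) = σ x * σ y) (hσinv : ∀ x : S, σ (σ x) = x)
    (μ : S →₀ ℂ) (f : S → ℂ)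
    (hf : ∀ x y : S, mint μ (fun t => f (x * σ y * t)) = f x * f y) :
    mint μ f ≠ 0 ↔ f ≠ 0 := by
  constructor
  · rintro h rfl
    exact h (by simp [mint])
  · intro h
    obtain ⟨a, ha⟩ := Function.ne_iff.mp h
    obtain ⟨g, hg⟩ := exists_eq_mint_mul σ hσmul hσinv μ f hf ha
    have hc : mint μ g ≠ 0 := fun hc => ha (by simp [hg a, hc])
    rw [funext hg, mint_const_mul]
    exact mul_ne_zero hc hc
end

section
/- Let f, g : S → ℂ satisfy the integral Kannappan-sine subtraction law ∫_S f(xσ(y)t) dμ(t) = f(x)g(y) − f(y)g(x) for all x, y ∈ S, and suppose f and g are linearly independent over ℂ. Then ∫_S f(t) dμ(t) = 0. -/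
/-- The integral against `μ` is linear in the integrand. -/
theorem mint_linear_comb {S : Type*} (μ : S →₀ ℂ) (h k : S → ℂ) (c d : ℂ) :
    mint μ (fun t => c * h t + d * k t) = c * mint μ h + d * mint μ k := by
  simp only [mint, Finsupp.sum, Finset.mul_sum, ← Finset.sum_add_distrib]
  exact Finset.sum_congr rfl fun t _ => by ring

/-- Two linearly independent functions have a nonvanishing `2 × 2` minor. -/
theorem exists_minor_ne_zero {S : Type*} (f g : S → ℂ)
    (hli : ∀ a b : ℂ, (∀ x : S, a * f x + b * g x = 0) → a = 0 ∧ b = 0) :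
    ∃ p q : S, f p * g q - f q * g p ≠ 0 := by
  by_contra! h
  have hf0 : ∀ p, f p = 0 := fun p => by
    have := (hli (-g p) (f p) fun x => by linear_combination h p x).2
    exact this
  exact one_ne_zero (hli 1 0 fun x => by simp [hf0 x]).1

/-- Coefficients with respect to two linearly independent functions are unique. -/
theorem coeffs_unique {S : Type*} {f g : S → ℂ}
    (hli : ∀ a b : ℂ, (∀ x : S, a * f x + b * g x = 0) → a = 0 ∧ b = 0) {a b c d : ℂ}
    (h : ∀ x, a * f x + b * g x = c * f x + d * g x) : a = c ∧ b = d := by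
  have := hli (a - c) (b - d) fun x => by linear_combination h x
  exact ⟨sub_eq_zero.1 this.1, sub_eq_zero.1 this.2⟩

theorem stmt_2 {S : Type*} [Semigroup S] (σ : S → S)
    (hσmul : ∀ x y : S, σ (x * y) = σ x * σ y) (hσinv : ∀ x : S, σ (σ x) = x)
    (μ : S →₀ ℂ) (f g : S → ℂ)
    (hf : ∀ x y : S, mint μ (fun t => f (x * σ y * t)) = f x * g y - f y * g x)
    (hli : ∀ a b : ℂ, (∀ x : S, a * f x + b * g x = 0) → a = 0 ∧ b = 0) :
    mint μ f = 0 := by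
  have hD : ∀ x y z : S, f (x * y) * g z - f z * g (x * y) =
      f x * g (σ y * z) - f (σ y * z) * g x := fun x y z => by
    rw [← hf, ← hf, hσmul, hσinv]
    simp only [mul_assoc]
  -- Right translations act on the span of `f` and `g` by a matrix `!![A, B; C, E]`.
  obtain ⟨A, B, C, E, hF, hG⟩ : ∃ A B C E : S → ℂ,
      (∀ x y, f (x * y) = A y * f x + B y * g x) ∧
      (∀ x y, g (x * y) = C y * f x + E y * g x) := by
    obtain ⟨p, q, hpq⟩ := exists_minor_ne_zero f g hli
    refine ⟨fun y => (f p * g (σ y * q) - f q * g (σ y * p)) / (f p * g q - f q * g p),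
      fun y => (f q * f (σ y * p) - f p * f (σ y * q)) / (f p * g q - f q * g p),
      fun y => (g p * g (σ y * q) - g q * g (σ y * p)) / (f p * g q - f q * g p),
      fun y => (g q * f (σ y * p) - g p * f (σ y * q)) / (f p * g q - f q * g p),
      fun x y => ?_, fun x y => ?_⟩
    · rw [div_mul_eq_mul_div, div_mul_eq_mul_div, ← add_div, eq_div_iff hpq]
      linear_combination f p * hD x y q - f q * hD x y p
    · rw [div_mul_eq_mul_div, div_mul_eq_mul_div, ← add_div, eq_div_iff hpq]
      linear_combination g p * hD x y q - g q * hD x y p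
  -- Left translation by `σ y` acts by the adjugate of that matrix.
  have hL : ∀ y z, g (σ y * z) = A y * g z - C y * f z ∧
      -f (σ y * z) = B y * g z - E y * f z := fun y z =>
    coeffs_unique hli fun x => by
      linear_combination -hD x y z + g z * hF x y - f z * hG x y
  have hcomm : ∀ y w, B y * C w = B w * C y ∧
      E y * B w - B y * E w = B w * A y - A w * B y := fun y w => by
    have := coeffs_unique hli (a := E y * A w - B y * C w) (b := E y * B w - B y * E w)
      (c := A w * E y - B w * C y) (d := B w * A y - A w * B y) fun z => by
        have h1 := (hL y (z * w)).2
        rw [← mul_assoc, hF (σ y * z) w, hF z w, hG z w] at h1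
        linear_combination h1 - A w * (hL y z).2 + B w * (hL y z).1
    exact ⟨by linear_combination -this.1, this.2⟩
  have hv : ∀ y, mint μ A * A (σ y) + mint μ B * C (σ y) = g y ∧
      mint μ A * B (σ y) + mint μ B * E (σ y) = -f y := fun y =>
    coeffs_unique hli fun x => by
      have h1 := hf x y
      have h2 : (fun t => f (x * σ y * t)) =
          fun t => f (x * σ y) * A t + g (x * σ y) * B t := by
        funext t
        rw [hF]
        ring
      rw [h2, mint_linear_comb] at h1
      linear_combination h1 - mint μ A * hF x (σ y) - mint μ B * hG x (σ y)
  have hσ : ∀ y, A y = E (σ y) ∧ B y = -B (σ y) := fun y =>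
    coeffs_unique hli fun x => by
      have h1 := (hL (σ x) y).2
      rw [hσinv] at h1
      have hc := hcomm (σ x) (σ y)
      linear_combination -hF x y - h1 + E (σ x) * (hv y).2 + B (σ x) * (hv y).1
        - E (σ y) * (hv x).2 - B (σ y) * (hv x).1
        - mint μ A * hc.2 - mint μ B * hc.1
  have hfAB : f = fun y => mint μ A * B y + (-mint μ B) * A y := by
    funext y
    linear_combination (hv y).2 - mint μ A * (hσ y).2 + mint μ B * (hσ y).1
  rw [hfAB, mint_linear_comb]
  ring
end

section
/- Let f, g : S → ℂ satisfy the integral Kannappan-sine subtraction law ∫_S f(xσ(y)t) dμ(t) = f(x)g(y) − f(y)g(x) for all x, y ∈ S, and suppose f and g are linearly independent over ℂ. If ∫_S ∫_S g(σ(s)k) dμ(s)dμ(k) = 0, then ∫_S ∫_S f(σ(s)k) dμ(s)dμ(k) ≠ 0. -/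
theorem mint_linear {S : Type*} (μ : S →₀ ℂ) (h k : S → ℂ) (a b : ℂ) :
    mint μ (fun t => a * h t + b * k t) = a * mint μ h + b * mint μ k := by
  simp only [mint, Finsupp.sum, Finset.mul_sum, ← Finset.sum_add_distrib]
  exact Finset.sum_congr rfl fun t _ => by ring

theorem mint_mul_left {S : Type*} (μ : S →₀ ℂ) (h : S → ℂ) (a : ℂ) :
    mint μ (fun t => a * h t) = a * mint μ h := by
  simpa using mint_linear μ h h a 0

theorem mint_comm {S : Type*} (μ : S →₀ ℂ) (h : S → S → ℂ) :
    mint μ (fun s => mint μ (fun t => h s t)) = mint μ (fun t => mint μ (fun s => h s t)) := by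
  simp only [mint, Finsupp.sum, Finset.mul_sum]
  rw [Finset.sum_comm]
  exact Finset.sum_congr rfl fun t _ => Finset.sum_congr rfl fun s _ => by ring

/-- Nonzero solutions of `∫ χ(xσ(y)t) dμ(t) = χ(x) χ'(y)` and `∫ χ(xσ(s)y) dμ(s) = χ(x) χ(y)`
are multiples of multiplicative functions. -/
theorem mint_mint_ne_zero_of_multiplicative {S : Type*} [Semigroup S] (σ : S → S)
    (hσmul : ∀ x y : S, σ (x * y) = σ x * σ y) (hσinv : ∀ x : S, σ (σ x) = x)
    (μ : S →₀ ℂ) (χ χ' : S → ℂ)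
    (hχ : ∀ x y, mint μ (fun t => χ (x * σ y * t)) = χ x * χ' y)
    (hsand : ∀ x y, mint μ (fun s => χ (x * σ s * y)) = χ x * χ y)
    (hne : ∃ x, χ x ≠ 0) (hne' : ∃ x, χ' x ≠ 0) :
    mint μ (fun s => mint μ (fun k => χ (σ s * k))) ≠ 0 := by
  obtain ⟨x₀, hx₀⟩ := hne
  obtain ⟨z₀, hz₀⟩ := hne'
  obtain ⟨m, hm⟩ : ∃ m : S → ℂ, ∀ x y, χ (x * y) = χ x * m y := by
    refine ⟨fun y => χ' (σ y * z₀) / χ' z₀, fun x y => ?_⟩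
    have h1 := hχ (x * y) z₀
    have h2 := hχ x (σ y * z₀)
    simp only [hσmul, hσinv, ← mul_assoc] at h2
    rw [h1] at h2
    field_simp
    exact h2
  have hmm : ∀ x y, m (x * y) = m x * m y := fun x y => by
    have h := hm x₀ (x * y)
    rw [← mul_assoc, hm, hm, mul_assoc] at h
    exact (mul_left_cancel₀ hx₀ h).symm
  have hb : ∀ y, χ y = mint μ (fun s => m (σ s)) * m y := fun y => by
    have h := hsand x₀ y
    simp only [hm, hmm, mul_assoc] at h
    rw [mint_mul_left] at h
    simp only [mul_comm _ (m y)] at h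
    rw [mint_mul_left] at h
    rw [mul_comm]
    exact (mul_left_cancel₀ hx₀ h).symm
  have ha : mint μ m ≠ 0 := fun h0 => by
    have h := hχ x₀ z₀
    simp only [hm] at h
    rw [mint_mul_left, h0, mul_zero] at h
    exact mul_ne_zero hx₀ hz₀ h.symm
  have hb0 : mint μ (fun s => m (σ s)) ≠ 0 := fun h0 => hx₀ (by rw [hb, h0, zero_mul])
  simp only [hm, mint_mul_left]
  simp only [hb, mul_comm _ (mint μ m), mint_mul_left]
  exact mul_ne_zero ha (mul_ne_zero hb0 hb0)

theorem stmt_6 {S : Type*} [Semigroup S] (σ : S → S)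
    (hσmul : ∀ x y : S, σ (x * y) = σ x * σ y) (hσinv : ∀ x : S, σ (σ x) = x)
    (μ : S →₀ ℂ) (f g : S → ℂ)
    (hf : ∀ x y : S, mint μ (fun t => f (x * σ y * t)) = f x * g y - f y * g x)
    (hli : ∀ a b : ℂ, (∀ x : S, a * f x + b * g x = 0) → a = 0 ∧ b = 0)
    (hg0 : mint μ (fun s => mint μ (fun k => g (σ s * k))) = 0) :
    mint μ (fun s => mint μ (fun k => f (σ s * k))) ≠ 0 := by
  intro hf0
  obtain ⟨z₀, hz₀⟩ : ∃ z, f z ≠ 0 := by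
    by_contra! h
    exact one_ne_zero (hli 1 0 fun x => by simp [h]).1
  have key : ∀ x y z, f z * mint μ (fun s => g (x * σ y * s)) =
      f x * (g y * g z - mint μ (fun s => g (y * σ s * z))) +
      g x * (mint μ (fun s => f (y * σ s * z)) - f y * g z) := fun x y z => by
    have h1 : mint μ (fun s => mint μ (fun t => f (x * σ y * s * σ z * t))) =
        g z * mint μ (fun s => f (x * σ y * s)) +
          (-f z) * mint μ (fun s => g (x * σ y * s)) := by
      rw [← mint_linear]
      congr 1; funext s
      rw [hf]; ring
    have h2 : mint μ (fun s => mint μ (fun t => f (x * σ y * s * σ z * t))) =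
        f x * mint μ (fun s => g (y * σ s * z)) +
          (-g x) * mint μ (fun s => f (y * σ s * z)) := by
      rw [← mint_linear]
      congr 1; funext s
      have h := hf x (y * σ s * z)
      simp only [hσmul, hσinv, ← mul_assoc] at h
      rw [h]; ring
    rw [h1, hf] at h2
    linear_combination -h2
  obtain ⟨φ, ψ, hB⟩ : ∃ φ ψ : S → ℂ, ∀ x y,
      mint μ (fun s => g (x * σ y * s)) = f x * φ y + g x * ψ y := by
    refine ⟨fun y => (g y * g z₀ - mint μ (fun s => g (y * σ s * z₀))) / f z₀,
      fun y => (mint μ (fun s => f (y * σ s * z₀)) - f y * g z₀) / f z₀, fun x y => ?_⟩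
    have h := key x y z₀
    field_simp
    linear_combination h
  have hCD : ∀ y z, mint μ (fun s => g (y * σ s * z)) = g y * g z - f z * φ y ∧
      mint μ (fun s => f (y * σ s * z)) = f z * ψ y + f y * g z := fun y z => by
    have h := hli (f z * φ y - (g y * g z - mint μ (fun s => g (y * σ s * z))))
      (f z * ψ y - (mint μ (fun s => f (y * σ s * z)) - f y * g z)) fun x => by
        have h := key x y z
        rw [hB] at h
        linear_combination h
    exact ⟨by linear_combination h.1, by linear_combination -h.2⟩
  have hprop : ∀ x y, f y * φ x = f x * φ y ∧ f y * (ψ x - g x) = f x * (ψ y - g y) :=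
    fun x y => by
    have h := hli (f y * φ x - f x * φ y) (f y * (ψ x - g x) - f x * (ψ y - g y)) fun z => by
      have h1 : mint μ (fun s => mint μ (fun t => f (y * σ s * z * σ x * t))) =
          g x * mint μ (fun s => f (y * σ s * z)) +
            (-f x) * mint μ (fun s => g (y * σ s * z)) := by
        rw [← mint_linear]
        congr 1; funext s
        rw [hf]; ring
      have h2 : mint μ (fun s => mint μ (fun t => f (y * σ s * z * σ x * t))) =
          ψ y * mint μ (fun t => f (z * σ x * t)) +
            f y * mint μ (fun t => g (z * σ x * t)) := by
        rw [mint_comm, ← mint_linear]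
        congr 1; funext t
        have h := (hCD y (z * σ x * t)).2
        simp only [← mul_assoc] at h
        rw [h]; ring
      rw [h1, hf, hB, (hCD y z).1, (hCD y z).2] at h2
      linear_combination -h2
    exact ⟨sub_eq_zero.1 h.1, sub_eq_zero.1 h.2⟩
  obtain ⟨c, hc⟩ : ∃ c, ∀ y, φ y = c * f y := ⟨φ z₀ / f z₀, fun y => by
    have h := (hprop z₀ y).1
    field_simp
    linear_combination -h⟩
  obtain ⟨d, hd⟩ : ∃ d, ∀ y, ψ y = g y + d * f y := ⟨(ψ z₀ - g z₀) / f z₀, fun y => by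
    have h := (hprop z₀ y).2
    field_simp
    linear_combination -h⟩
  obtain ⟨p, q, hpq, hpq'⟩ : ∃ p q : ℂ, p + q = d ∧ p * q = c := by
    obtain ⟨r, hr⟩ := IsAlgClosed.exists_pow_nat_eq (d ^ 2 - 4 * c) (n := 2) (by norm_num)
    exact ⟨(d + r) / 2, (d - r) / 2, by ring, by linear_combination -hr / 4⟩
  have hne : ∀ l : ℂ, ∃ x, l * f x + 1 * g x ≠ 0 := fun l => by
    by_contra! h
    exact one_ne_zero (hli l 1 h).2
  refine mint_mint_ne_zero_of_multiplicative σ hσmul hσinv μ (fun x => p * f x + 1 * g x)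
    (fun x => q * f x + 1 * g x) (fun x y => ?_) (fun x y => ?_) (hne p) (hne q) ?_
  · rw [mint_linear, hf, hB, hc, hd, ← hpq, ← hpq']; ring
  · rw [mint_linear, (hCD x y).1, (hCD x y).2, hc, hd, ← hpq, ← hpq']; ring
  · simp only [mint_linear, hf0, hg0, mul_zero, add_zero]
end

section
/- Let γ, b ∈ ℂ\{0}, c ∈ ℂ\{1, −1}, and let χ be an exponential on S with χ ≠ χ∘σ, ∫_S χ(t) dμ(t) = −2b/(1+c) and ∫_S χ∘σ(t) dμ(t) = 2b/(1−c). Then f := (χ+χ∘σ)/(2γ) + c(χ−χ∘σ)/(2γ) and g := b(χ−χ∘σ) satisfy ∫_S f(xσ(y)t) dμ(t) = f(x)g(y) − f(y)g(x) for all x, y ∈ S. -/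
/-- The integral against a finitely supported measure is linear. -/
theorem mint_linear_combination {S : Type*} (μ : S →₀ ℂ) (p q : ℂ) (h k : S → ℂ) :
    mint μ (fun t => p * h t + q * k t) = p * mint μ h + q * mint μ k := by
  simp only [mint, Finsupp.sum, Finset.mul_sum, ← Finset.sum_add_distrib]
  exact Finset.sum_congr rfl fun t _ => by ring

theorem stmt_8 {S : Type*} [Semigroup S] (σ : S → S)
    (hσmul : ∀ x y : S, σ (x * y) = σ x * σ y) (hσinv : ∀ x : S, σ (σ x) = x)
    (μ : S →₀ ℂ) (γ b c : ℂ) (hγ : γ ≠ 0) (hb : b ≠ 0) (hc1 : c ≠ 1) (hc2 : c ≠ -1)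
    (χ : S → ℂ) (hχmul : ∀ x y : S, χ (x * y) = χ x * χ y) (hχ0 : χ ≠ 0)
    (hne : χ ≠ fun x => χ (σ x))
    (hint1 : mint μ χ = -2 * b / (1 + c))
    (hint2 : mint μ (fun t => χ (σ t)) = 2 * b / (1 - c))
    (f g : S → ℂ)
    (hfdef : f = fun x => (χ x + χ (σ x)) / (2 * γ) + c * (χ x - χ (σ x)) / (2 * γ))
    (hgdef : g = fun x => b * (χ x - χ (σ x))) :
    ∀ x y : S, mint μ (fun t => f (x * σ y * t)) = f x * g y - f y * g x := by
  intro x y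
  have hc1' : 1 - c ≠ 0 := sub_ne_zero.mpr hc1.symm
  have hc2' : 1 + c ≠ 0 := fun h => hc2 (eq_neg_of_add_eq_zero_right h)
  have hf : (fun t => f (x * σ y * t)) = fun t =>
      (1 + c) / (2 * γ) * (χ x * χ (σ y)) * χ t
        + (1 - c) / (2 * γ) * (χ (σ x) * χ y) * χ (σ t) := by
    funext t
    simp only [hfdef, hσmul, hσinv, hχmul]
    ring
  rw [hf, mint_linear_combination μ _ _ χ (fun t => χ (σ t)), hint1, hint2, hfdef, hgdef]
  field_simp
  ring
end

section
/- Let f, g : S → ℂ satisfy the integral Kannappan-sine addition law ∫_S f(xσ(y)t) dμ(t) = f(x)g(y) + f(y)g(x) for all x, y ∈ S, with ∫_S f(t) dμ(t) = 0 and f, g linearly independent over ℂ. If ∫_S ∫_S g(σ(t)s) dμ(s)dμ(t) = 0, then ∫_S ∫_S f(σ(t)s) dμ(s)dμ(t) ≠ 0. -/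
section Mint

variable {S : Type*}

theorem mint_zero (h : S → ℂ) : mint 0 h = 0 := by simp [mint]

theorem mint_add (μ ν : S →₀ ℂ) (h : S → ℂ) : mint (μ + ν) h = mint μ h + mint ν h :=
  Finsupp.sum_add_index' (by simp) fun _ _ _ => add_mul _ _ _

theorem mint_single (a : S) (r : ℂ) (h : S → ℂ) : mint (Finsupp.single a r) h = r * h a :=
  Finsupp.sum_single_index (by simp)

/-- The linear extension of `h : S → ℂ` to the semigroup algebra of `S`. -/
noncomputable def linearExtension (h : S → ℂ) : MonoidAlgebra ℂ S →ₗ[ℂ] ℂ :=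
  Finsupp.linearCombination ℂ h ∘ₗ (MonoidAlgebra.coeffLinearEquiv ℂ).toLinearMap

theorem linearExtension_single (h : S → ℂ) (a : S) (r : ℂ) :
    linearExtension h (.single a r) = r * h a := by
  simp [linearExtension]

theorem linearExtension_single_mul [Mul S] (μ : S →₀ ℂ) (h : S → ℂ) (a : S) (r : ℂ) :
    linearExtension h (.single a r * .ofCoeff μ) = r * mint μ fun t => h (a * t) := by
  induction μ using Finsupp.induction_linear with
  | zero => simp [mint_zero]
  | add μ ν h₁ h₂ => rw [MonoidAlgebra.ofCoeff_add, mul_add, map_add, h₁, h₂, mint_add, mul_add]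
  | single b s =>
    rw [MonoidAlgebra.ofCoeff_single, MonoidAlgebra.single_mul_single, linearExtension_single,
      mint_single, mul_assoc]

theorem linearExtension_map_mul [Mul S] (σ : S → S) (μ ν : S →₀ ℂ) (h : S → ℂ) :
    linearExtension h (MonoidAlgebra.mapDomainLinearMap ℂ ℂ σ (.ofCoeff ν) * .ofCoeff μ) =
      mint ν fun t => mint μ fun s => h (σ t * s) := by
  induction ν using Finsupp.induction_linear with
  | zero => simp [mint_zero]
  | add ν₁ ν₂ h₁ h₂ =>
    rw [MonoidAlgebra.ofCoeff_add, map_add, add_mul, map_add, h₁, h₂, mint_add]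
  | single b s =>
    rw [MonoidAlgebra.ofCoeff_single, MonoidAlgebra.mapDomainLinearMap_single,
      linearExtension_single_mul, mint_single]

end Mint

section Abstract

variable {A : Type*} [NonUnitalRing A] [Module ℂ A]

theorem exists_cosine_law (σ : A →ₗ[ℂ] A)
    (hσmul : ∀ x y : A, σ (x * y) = σ x * σ y) (hσinv : ∀ x : A, σ (σ x) = x)
    (m : A) (f g : A →ₗ[ℂ] ℂ)
    (hf : ∀ x y : A, f (x * σ y * m) = f x * g y + f y * g x)
    (hli : ∀ a b : ℂ, (∀ x : A, a * f x + b * g x = 0) → a = 0 ∧ b = 0) :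
    ∃ c : ℂ, ∀ x y : A, g (x * σ y * m) = g x * g y + c * (f x * f y) := by
  obtain ⟨w, hw⟩ : ∃ w, f w ≠ 0 := by
    by_contra! h
    exact one_ne_zero (hli 1 0 fun x => by simp [h x]).1
  have key : ∀ x y z : A, f x * g (z * σ m * y) + f (z * σ m * y) * g x
      = (f x * g z + f z * g x) * g y + f y * g (x * σ z * m) := by
    intro x y z
    rw [← hf x (z * σ m * y), ← hf x z, ← hf]
    simp only [hσmul, hσinv, mul_assoc]
  obtain ⟨h, k, hk⟩ : ∃ h k : A → ℂ, ∀ x z, g (x * σ z * m) = f x * h z + g x * k z := by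
    refine ⟨fun z => (g (z * σ m * w) - g z * g w) / f w,
      fun z => (f (z * σ m * w) - f z * g w) / f w, fun x z => ?_⟩
    field_simp
    linear_combination -key x w z
  have split : ∀ z y, g (z * σ m * y) = g z * g y + f y * h z ∧
      f (z * σ m * y) = f z * g y + f y * k z := by
    intro z y
    have := hli (g (z * σ m * y) - (g z * g y + f y * h z))
      (f (z * σ m * y) - (f z * g y + f y * k z)) fun x => by
        linear_combination key x y z + f y * hk x z
    exact ⟨sub_eq_zero.1 this.1, sub_eq_zero.1 this.2⟩
  have comp : ∀ z u, f z * h u = f u * h z ∧ f z * k u + f u * k z = f z * g u + f u * g z := by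
    intro z u
    have := hli (f z * h u - f u * h z)
      (f z * k u + f u * k z - (f z * g u + f u * g z)) fun y => by
        have e1 := (split z (y * σ u * m)).2
        have e2 := hf (z * σ m * y) u
        have e3 : z * σ m * (y * σ u * m) = z * σ m * y * σ u * m := by simp only [mul_assoc]
        rw [e3, e2, (split z y).1, (split z y).2, hk, hf] at e1
        linear_combination -e1
    exact ⟨sub_eq_zero.1 this.1, sub_eq_zero.1 this.2⟩
  have hkw : k w = g w := by
    have := (comp w w).2
    exact mul_left_cancel₀ hw (by linear_combination this / 2)
  refine ⟨h w / f w, fun x y => ?_⟩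
  have h1 : h y = h w / f w * f y := by
    field_simp
    linear_combination (comp w y).1
  have h2 : k y = g y := mul_left_cancel₀ hw (by
    linear_combination (comp w y).2 - f y * hkw)
  rw [hk, h1, h2]
  ring

theorem apply_map_mul_ne_zero (σ : A →ₗ[ℂ] A)
    (hσmul : ∀ x y : A, σ (x * y) = σ x * σ y) (hσinv : ∀ x : A, σ (σ x) = x)
    (m : A) (f g : A →ₗ[ℂ] ℂ)
    (hf : ∀ x y : A, f (x * σ y * m) = f x * g y + f y * g x)
    (hli : ∀ a b : ℂ, (∀ x : A, a * f x + b * g x = 0) → a = 0 ∧ b = 0)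
    (hg0 : g (σ m * m) = 0) : f (σ m * m) ≠ 0 := by
  intro hf0
  obtain ⟨c, hg⟩ := exists_cosine_law σ hσmul hσinv m f g hf hli
  let φ : A → QuadraticAlgebra ℂ c 0 := fun x => ⟨g x, f x⟩
  have hφ : ∀ x y, φ (x * σ y * m) = φ x * φ y := by
    intro x y
    ext
    · simp [φ, hg]; ring
    · simp [φ, hf]; ring
  have cancel : ∀ P, (∀ x, φ x * P = 0) → P = 0 := by
    intro P hP
    have := hli P.re P.im fun x => by
      have := congrArg QuadraticAlgebra.im (hP x)
      simp [φ] at this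
      linear_combination this
    ext
    · exact this.1
    · exact this.2
  have shift : ∀ x y z, φ (x * σ y) * φ z = φ x * φ (y * z) := by
    intro x y z
    rw [← hφ, ← hφ, hσmul]
    simp only [mul_assoc]
  have shift_m : ∀ x z, φ (x * m) * φ z = φ x * φ (σ m * z) := by
    intro x z
    rw [← shift, hσinv]
  have h0 : φ (σ m * m) = 0 := by ext <;> simp [φ, hf0, hg0]
  have hm' : ∀ x, φ (σ m * x) * φ (σ m) = 0 := by
    intro x
    have h1 := shift (σ m) (σ m) x
    rw [hσinv, h0, zero_mul] at h1
    rw [mul_comm, ← h1]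
  have hσm : φ (σ m) = 0 := by
    refine cancel _ fun x => cancel _ fun y => cancel _ fun z => ?_
    calc φ z * (φ y * (φ x * φ (σ m))) = φ (z * σ y * m) * φ x * φ (σ m) := by rw [hφ]; ring
      _ = φ (z * σ y) * (φ (σ m * x) * φ (σ m)) := by rw [shift_m]; ring
      _ = 0 := by rw [hm', mul_zero]
  have hleft : ∀ z, φ (σ m * z) = 0 := by
    intro z
    refine cancel _ fun x => cancel _ fun y => ?_
    have hmm : φ (y * σ x * m * m) = 0 := by
      have := hφ (y * σ x) (σ m)
      rwa [hσinv, hσm, mul_zero] at this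
    rw [← mul_assoc, ← hφ, ← shift_m, hmm, zero_mul]
  have hone : (1 : QuadraticAlgebra ℂ c 0) = 0 := by
    refine cancel _ fun x => ?_
    rw [mul_one]
    refine cancel _ fun y => cancel _ fun z => ?_
    rw [← mul_assoc, ← hφ, shift_m, hleft, mul_zero]
  exact one_ne_zero (congrArg QuadraticAlgebra.re hone)

end Abstract

theorem stmt_13 {S : Type*} [Semigroup S] (σ : S → S)
    (hσmul : ∀ x y : S, σ (x * y) = σ x * σ y) (hσinv : ∀ x : S, σ (σ x) = x)
    (μ : S →₀ ℂ) (f g : S → ℂ)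
    (hf : ∀ x y : S, mint μ (fun t => f (x * σ y * t)) = f x * g y + f y * g x)
    (hf0 : mint μ f = 0)
    (hli : ∀ a b : ℂ, (∀ x : S, a * f x + b * g x = 0) → a = 0 ∧ b = 0)
    (hg0 : mint μ (fun t => mint μ (fun s => g (σ t * s))) = 0) :
    mint μ (fun t => mint μ (fun s => f (σ t * s))) ≠ 0 := by
  have map_mul (x y : MonoidAlgebra ℂ S) :
      MonoidAlgebra.mapDomainLinearMap ℂ ℂ σ (x * y) =
        MonoidAlgebra.mapDomainLinearMap ℂ ℂ σ x * MonoidAlgebra.mapDomainLinearMap ℂ ℂ σ y := by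
    induction x using MonoidAlgebra.induction_linear with
    | zero => simp
    | add x₁ x₂ h₁ h₂ => simp only [add_mul, map_add, h₁, h₂]
    | single a r =>
      induction y using MonoidAlgebra.induction_linear with
      | zero => simp
      | add y₁ y₂ h₁ h₂ => simp only [mul_add, map_add, h₁, h₂]
      | single b s => simp [MonoidAlgebra.single_mul_single, hσmul]
  have map_inv (x : MonoidAlgebra ℂ S) :
      MonoidAlgebra.mapDomainLinearMap ℂ ℂ σ (MonoidAlgebra.mapDomainLinearMap ℂ ℂ σ x) = x := by
    induction x using MonoidAlgebra.induction_linear with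
    | zero => simp
    | add x₁ x₂ h₁ h₂ => simp only [map_add, h₁, h₂]
    | single a r => simp [hσinv]
  have law (x y : MonoidAlgebra ℂ S) :
      linearExtension f (x * MonoidAlgebra.mapDomainLinearMap ℂ ℂ σ y * .ofCoeff μ) =
        linearExtension f x * linearExtension g y + linearExtension f y * linearExtension g x := by
    induction x using MonoidAlgebra.induction_linear with
    | zero => simp
    | add x₁ x₂ h₁ h₂ =>
      simp only [add_mul, map_add, h₁, h₂]
      ring
    | single a r =>
      induction y using MonoidAlgebra.induction_linear with
      | zero => simp
      | add y₁ y₂ h₁ h₂ =>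
        simp only [mul_add, add_mul, map_add, h₁, h₂]
        ring
      | single b s =>
        rw [MonoidAlgebra.mapDomainLinearMap_single, MonoidAlgebra.single_mul_single,
          linearExtension_single_mul, hf]
        simp only [linearExtension_single]
        ring
  have indep (a b : ℂ)
      (h : ∀ x, a * linearExtension f x + b * linearExtension g x = 0) : a = 0 ∧ b = 0 :=
    hli a b fun x => by simpa [linearExtension_single] using h (.single x 1)
  rw [← linearExtension_map_mul] at hg0 ⊢
  exact apply_map_mul_ne_zero _ map_mul map_inv _ _ _ law indep hg0
end
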